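/- Let X be a set, T a ternary relation on X, and x ∈ X. Then the following are equivalent: (i) for all subsets P, Q ⊆ X, if [for all y, z, T x y z implies y ∈ P or z ∈ Q], then [for all y, z, T x y z implies y ∈ Q or z ∈ P]; (ii) for all y, z ∈ X, T x y z implies T x z y. (This is the local first-order correspondence of the axiom (A5): ∇(p, q) → ∇(q, p).) -/

import Mathlib

/-- Local first-order correspondence of the axiom (A5): `∇(p, q) → ∇(q, p)`.
At a point `x`, the modal formula holds under all valuations iff
`∀ y z, T x y z → T x z y`. -/
theorem correspondence_A5 {X : Type*} (T : X → X → X → Prop) (x : X) :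
    (∀ P Q : Set X, (∀ y z : X, T x y z → y ∈ P ∨ z ∈ Q) →
      (∀ y z : X, T x y z → y ∈ Q ∨ z ∈ P)) ↔
    (∀ y z : X, T x y z → T x z y) := by
  refine ⟨fun h y z hyz => ?_, fun h P Q hPQ y z hyz => (hPQ z y (h y z hyz)).symm⟩
  by_contra hzy
  have hPQ : ∀ a b : X, T x a b → a ∈ ({z}ᶜ : Set X) ∨ b ∈ ({y}ᶜ : Set X) := by
    intro a b hab
    by_contra! hne
    obtain ⟨rfl, rfl⟩ : a = z ∧ b = y := by simpa using hne
    exact hzy hab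
  simpa using h {z}ᶜ {y}ᶜ hPQ y z hyz
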